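/- Let k be an infinite field, (R, 𝔪, k) a commutative noetherian local k-algebra, and K = k(t). Given a finitely generated projective R⊗_k K-module P, there exist a finitely generated R-module X and a non-negative integer n such that P ⊕ (X⊗_k K) ≅ (R^n⊗_k K) ⊕ (X⊗_k K) as R⊗_k K-modules. -/

import Mathlib

open TensorProduct

noncomputable section

set_option maxHeartbeats 1000000
set_option synthInstance.maxHeartbeats 400000

/-- The ring `R ⊗_k K` with `K = k(t)` the rational function field. -/
def AK (k : Type) [Field k] (R : Type) [CommRing R] [Algebra k R] : Type :=
  R ⊗[k] RatFunc k

instance (k : Type) [Field k] (R : Type) [CommRing R] [Algebra k R] :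
    CommRing (AK k R) := inferInstanceAs (CommRing (R ⊗[k] RatFunc k))

instance (k : Type) [Field k] (R : Type) [CommRing R] [Algebra k R] :
    Algebra k (AK k R) := inferInstanceAs (Algebra k (R ⊗[k] RatFunc k))

instance (k : Type) [Field k] (R : Type) [CommRing R] [Algebra k R] :
    Algebra R (AK k R) := inferInstanceAs (Algebra R (R ⊗[k] RatFunc k))

section PolynomialLocalization

open Polynomial

variable {R A : Type*} [CommRing R] [CommRing A] [Algebra R A] [Algebra R[X] A]
  [IsScalarTower R R[X] A]
variable {X Y Z P : Type*} [AddCommGroup X] [Module R X] [AddCommGroup Y] [Module R Y]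
  [AddCommGroup Z] [Module R Z] [AddCommGroup P] [Module R P] [Module A P] [IsScalarTower R A P]

/-- Evaluation at `c` as a map `Z[t] → Z`, where `Z[t] = R[t] ⊗ Z`. -/
def polyEval (Z : Type*) [AddCommGroup Z] [Module R Z] (c : R) : R[X] ⊗[R] Z →ₗ[R] Z :=
  TensorProduct.lid R Z ∘ₗ LinearMap.rTensor Z (leval c)

@[simp]
lemma polyEval_tmul (c : R) (p : R[X]) (z : Z) : polyEval Z c (p ⊗ₜ z) = p.eval c • z := by
  simp [polyEval]

lemma polyEval_smul (c : R) (p : R[X]) (w : R[X] ⊗[R] Z) :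
    polyEval Z c (p • w) = p.eval c • polyEval Z c w := by
  induction w with
  | zero => simp
  | add x y hx hy => simp [hx, hy]
  | tmul q z => simp [smul_tmul', mul_smul]

lemma polyEval_liftBaseChange (c : R) (f : Y →ₗ[R] R[X] ⊗[R] Z) (w : R[X] ⊗[R] Y) :
    polyEval Z c (f.liftBaseChange R[X] w) = polyEval Z c (f (polyEval Y c w)) := by
  induction w with
  | zero => simp
  | add x y hx hy => simp [hx, hy]
  | tmul q z => simp [polyEval_smul]

variable (A) in
/-- The canonical map `Z[t] → A ⊗ Z` for an `R[t]`-algebra `A`. -/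
def polyTensor (Z : Type*) [AddCommGroup Z] [Module R Z] : R[X] ⊗[R] Z →ₗ[R] A ⊗[R] Z :=
  LinearMap.rTensor Z ((Algebra.linearMap R[X] A).restrictScalars R)

@[simp]
lemma polyTensor_tmul (p : R[X]) (z : Z) :
    polyTensor A Z (p ⊗ₜ z) = algebraMap R[X] A p ⊗ₜ z := rfl

lemma polyTensor_smul (p : R[X]) (w : R[X] ⊗[R] Z) :
    polyTensor A Z (p • w) = algebraMap R[X] A p • polyTensor A Z w := by
  induction w with
  | zero => simp
  | add x y hx hy => simp [hx, hy]
  | tmul q z => simp [smul_tmul', Algebra.smul_def]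

lemma polyTensor_liftBaseChange (f : A ⊗[R] Y →ₗ[A] A ⊗[R] Z) (F : Y →ₗ[R] R[X] ⊗[R] Z) (g : A)
    (hF : ∀ y, polyTensor A Z (F y) = g • f (1 ⊗ₜ y)) (w : R[X] ⊗[R] Y) :
    polyTensor A Z (F.liftBaseChange R[X] w) = g • f (polyTensor A Y w) := by
  induction w with
  | zero => simp
  | add x y hx hy => simp [hx, hy]
  | tmul q z =>
    rw [LinearMap.liftBaseChange_tmul, polyTensor_smul, hF, polyTensor_tmul, smul_comm, ← map_smul,
      smul_tmul', smul_eq_mul, mul_one]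

/-- A retraction `A → R[t]` of `R`-modules makes `Z[t] → A ⊗ Z` injective. -/
lemma polyTensor_leftInverse (ρ : A →ₗ[R] R[X]) (hρ : ∀ p, ρ (algebraMap R[X] A p) = p)
    (w : R[X] ⊗[R] Z) : LinearMap.rTensor Z ρ (polyTensor A Z w) = w := by
  induction w with
  | zero => simp
  | add x y hx hy => simp [hx, hy]
  | tmul q z => simp [hρ]

lemma polyTensor_injective (ρ : A →ₗ[R] R[X]) (hρ : ∀ p, ρ (algebraMap R[X] A p) = p) :
    Function.Injective (polyTensor A Z : R[X] ⊗[R] Z → A ⊗[R] Z) :=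
  Function.LeftInverse.injective (g := LinearMap.rTensor Z ρ) (polyTensor_leftInverse ρ hρ)

section Localization

variable (T : Submonoid R[X]) [IsLocalization T A]

include T in
lemma exists_smul_mem_range_polyTensor (z : A ⊗[R] Z) :
    ∃ g ∈ T, ∃ w, polyTensor A Z w = algebraMap R[X] A g • z := by
  induction z with
  | zero => exact ⟨1, T.one_mem, 0, by simp⟩
  | add x y hx hy =>
    obtain ⟨g, hg, w, hw⟩ := hx
    obtain ⟨g', hg', w', hw'⟩ := hy
    refine ⟨g * g', T.mul_mem hg hg', g' • w + g • w', ?_⟩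
    rw [map_add, polyTensor_smul, polyTensor_smul, hw, hw', smul_add, map_mul, mul_smul, mul_smul]
    congr 1
    exact smul_comm _ _ _
  | tmul a z =>
    obtain ⟨⟨p, g⟩, h⟩ := IsLocalization.surj T a
    exact ⟨g, g.2, p ⊗ₜ z, by rw [polyTensor_tmul, ← h, smul_tmul', smul_eq_mul, mul_comm]⟩

include T in
/-- A common denominator for a linear map out of a finitely generated extended module. -/
lemma exists_denominator [Module.Finite R Y] (f : A ⊗[R] Y →ₗ[A] A ⊗[R] Z) :
    ∃ g ∈ T, ∀ y, ∃ w, polyTensor A Z w = algebraMap R[X] A g • f (1 ⊗ₜ y) := by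
  suffices ∀ N : Submodule R Y, N.FG → ∃ g ∈ T, ∀ y ∈ N, ∃ w,
      polyTensor A Z w = algebraMap R[X] A g • f (1 ⊗ₜ y) by
    obtain ⟨g, hg, h⟩ := this ⊤ Module.Finite.fg_top
    exact ⟨g, hg, fun y => h y trivial⟩
  intro N hN
  refine Submodule.fg_induction (motive := fun N _ => ∃ g ∈ T, ∀ y ∈ N, ∃ w,
      polyTensor A Z w = algebraMap R[X] A g • f (1 ⊗ₜ y)) (fun x => ?_) (fun N₁ N₂ _ _ h₁ h₂ => ?_) N hN
  · obtain ⟨g, hg, w, hw⟩ := exists_smul_mem_range_polyTensor T (f (1 ⊗ₜ x))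
    refine ⟨g, hg, fun y hy => ?_⟩
    obtain ⟨r, rfl⟩ := Submodule.mem_span_singleton.1 hy
    refine ⟨r • w, ?_⟩
    rw [map_smul, hw, tmul_smul, LinearMap.map_smul_of_tower, smul_comm]
  · obtain ⟨g, hg, h⟩ := h₁
    obtain ⟨g', hg', h'⟩ := h₂
    refine ⟨g * g', T.mul_mem hg hg', fun y hy => ?_⟩
    obtain ⟨y₁, hy₁, y₂, hy₂, rfl⟩ := Submodule.mem_sup.1 hy
    obtain ⟨w, hw⟩ := h y₁ hy₁
    obtain ⟨w', hw'⟩ := h' y₂ hy₂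
    refine ⟨g' • w + g • w', ?_⟩
    rw [map_add, polyTensor_smul, polyTensor_smul, hw, hw', tmul_add, map_add, smul_add, map_mul,
      mul_smul, mul_smul]
    congr 1
    exact smul_comm _ _ _

include T in
/-- A linear map between extended modules becomes polynomial after multiplication by any
multiple of a suitable denominator. -/
lemma exists_polynomial_lift [Module.Finite R Y]
    (ρ : A →ₗ[R] R[X]) (hρ : ∀ p, ρ (algebraMap R[X] A p) = p)
    (f : A ⊗[R] Y →ₗ[A] A ⊗[R] Z) :
    ∃ g ∈ T, ∀ g', g ∣ g' → ∃ F : Y →ₗ[R] R[X] ⊗[R] Z,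
      ∀ y, polyTensor A Z (F y) = algebraMap R[X] A g' • f (1 ⊗ₜ y) := by
  obtain ⟨g, hg, h⟩ := exists_denominator T f
  refine ⟨g, hg, ?_⟩
  rintro _ ⟨q, rfl⟩
  refine ⟨LinearMap.rTensor Z ρ ∘ₗ ((algebraMap R[X] A (g * q) • f).restrictScalars R) ∘ₗ
    TensorProduct.mk R A Y 1, fun y => ?_⟩
  obtain ⟨w, hw⟩ := h y
  have key : algebraMap R[X] A (g * q) • f (1 ⊗ₜ y) = polyTensor A Z (q • w) := by
    rw [polyTensor_smul, hw, ← mul_smul, map_mul, mul_comm]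
  simp only [LinearMap.comp_apply, LinearMap.restrictScalars_apply, LinearMap.smul_apply,
    TensorProduct.mk_apply, key, polyTensor_leftInverse ρ hρ]

include T in
omit [Module R P] [IsScalarTower R A P] in
/-- Specialization: if `A ⊗ Y ≃ (A ⊗ X) × P` with `P` finitely generated projective, then
evaluating at a point where all denominators are units splits `Y` as `X × R ^ n`. -/
lemma exists_equiv_prod_of_baseChange [IsLocalRing R] [Module.Finite R X] [Module.Finite R Y]
    [Module.Finite A P] [Module.Projective A P]
    (ρ : A →ₗ[R] R[X]) (hρ : ∀ p, ρ (algebraMap R[X] A p) = p)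
    (hT : ∀ g ∈ T, ∃ c, IsUnit (g.eval c))
    (e : (A ⊗[R] Y) ≃ₗ[A] ((A ⊗[R] X) × P)) :
    ∃ n : ℕ, Nonempty (Y ≃ₗ[R] X × (Fin n → R)) := by
  obtain ⟨m, π, hπ⟩ := Module.Finite.exists_fin' A P
  obtain ⟨σ, hσ⟩ := Module.projective_lifting_property π LinearMap.id hπ
  let u : A ⊗[R] (Fin m → R) ≃ₗ[A] (Fin m → A) := piScalarRight R A A (Fin m)
  let φ : A ⊗[R] X →ₗ[A] A ⊗[R] Y := e.symm.toLinearMap ∘ₗ LinearMap.inl A _ _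
  let r : A ⊗[R] Y →ₗ[A] A ⊗[R] X := LinearMap.fst A _ _ ∘ₗ e.toLinearMap
  let β : A ⊗[R] Y →ₗ[A] A ⊗[R] (Fin m → R) :=
    u.symm.toLinearMap ∘ₗ σ ∘ₗ LinearMap.snd A _ _ ∘ₗ e.toLinearMap
  let α : A ⊗[R] (Fin m → R) →ₗ[A] A ⊗[R] Y :=
    e.symm.toLinearMap ∘ₗ LinearMap.inr A _ _ ∘ₗ π ∘ₗ u.toLinearMap
  have hrφ : ∀ x, r (φ x) = x := by simp [r, φ]
  have hsum : ∀ y, φ (r y) + α (β y) = y := by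
    intro y
    have : π (σ (e y).2) = (e y).2 := LinearMap.congr_fun hσ _
    apply e.injective
    simp [φ, r, α, β, this]
  obtain ⟨g₁, hg₁, h₁⟩ := exists_polynomial_lift T ρ hρ φ
  obtain ⟨g₂, hg₂, h₂⟩ := exists_polynomial_lift T ρ hρ r
  obtain ⟨g₃, hg₃, h₃⟩ := exists_polynomial_lift T ρ hρ α
  obtain ⟨g₄, hg₄, h₄⟩ := exists_polynomial_lift T ρ hρ β
  set g := g₁ * g₂ * g₃ * g₄ with hg
  have hgT : g ∈ T := T.mul_mem (T.mul_mem (T.mul_mem hg₁ hg₂) hg₃) hg₄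
  obtain ⟨Φ, hΦ⟩ := h₁ g ⟨g₂ * g₃ * g₄, by rw [hg]; ring⟩
  obtain ⟨S, hS⟩ := h₂ g ⟨g₁ * g₃ * g₄, by rw [hg]; ring⟩
  obtain ⟨α', hα⟩ := h₃ g ⟨g₁ * g₂ * g₄, by rw [hg]; ring⟩
  obtain ⟨β', hβ⟩ := h₄ g ⟨g₁ * g₂ * g₃, by rw [hg]; ring⟩
  obtain ⟨c, hc⟩ := hT g hgT
  have hrφ' : ∀ x, polyEval X c (S (polyEval Y c (Φ x))) = (g.eval c) ^ 2 • x := by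
    intro x
    rw [← polyEval_liftBaseChange]
    have : S.liftBaseChange R[X] (Φ x) = (g ^ 2) ⊗ₜ x := by
      apply polyTensor_injective ρ hρ
      rw [polyTensor_liftBaseChange r S _ hS, hΦ, map_smul, hrφ, polyTensor_tmul, smul_tmul',
        smul_tmul', smul_eq_mul, smul_eq_mul, mul_one, map_pow, sq]
    rw [this]; simp
  have hsum' : ∀ y, polyEval Y c (Φ (polyEval X c (S y))) +
      polyEval Y c (α' (polyEval _ c (β' y))) = (g.eval c) ^ 2 • y := by
    intro y
    rw [← polyEval_liftBaseChange, ← polyEval_liftBaseChange, ← map_add]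
    have : Φ.liftBaseChange R[X] (S y) + α'.liftBaseChange R[X] (β' y) = (g ^ 2) ⊗ₜ y := by
      apply polyTensor_injective ρ hρ
      rw [map_add, polyTensor_liftBaseChange φ Φ _ hΦ, polyTensor_liftBaseChange α α' _ hα, hS, hβ,
        map_smul, map_smul, ← smul_add, ← smul_add, hsum, polyTensor_tmul, smul_tmul',
        smul_tmul', smul_eq_mul, smul_eq_mul, mul_one, map_pow, sq]
    rw [this]; simp
  obtain ⟨v, hv⟩ := (hc.pow 2).exists_left_inv
  let Φc : X →ₗ[R] Y := polyEval Y c ∘ₗ Φ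
  let Sc : Y →ₗ[R] X := v • polyEval X c ∘ₗ S
  let αc : (Fin m → R) →ₗ[R] Y := v • polyEval Y c ∘ₗ α'
  let βc : Y →ₗ[R] (Fin m → R) := polyEval _ c ∘ₗ β'
  have h1 : ∀ x, Sc (Φc x) = x := fun x => by
    simp only [Sc, Φc, LinearMap.smul_apply, LinearMap.comp_apply, hrφ', ← mul_smul, hv, one_smul]
  have h2 : ∀ y, Φc (Sc y) + αc (βc y) = y := fun y => by
    simp only [Sc, Φc, αc, βc, LinearMap.smul_apply, LinearMap.comp_apply, map_smul, ← smul_add,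
      hsum', ← mul_smul, hv, one_smul]
  let C := LinearMap.ker Sc
  have hproj : ∀ y, Sc (y - Φc (Sc y)) = 0 := fun y => by rw [map_sub, h1, sub_self]
  obtain ⟨q, hq⟩ : ∃ q : Y →ₗ[R] C, ∀ y, (q y : Y) = y - Φc (Sc y) :=
    ⟨(LinearMap.id - Φc ∘ₗ Sc).codRestrict C hproj, fun _ => rfl⟩
  have hqC : ∀ z : C, q z = z := fun z => by
    have : Sc z = 0 := z.2
    ext
    rw [hq, this, map_zero, sub_zero]
  have : Module.Finite R C := Module.Finite.of_surjective q fun z => ⟨z, hqC z⟩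
  have : Module.Projective R C := by
    refine Module.Projective.of_split (βc ∘ₗ C.subtype) (q ∘ₗ αc) ?_
    ext1 z
    have hz : Sc z = 0 := z.2
    have := h2 z
    rw [hz, map_zero, zero_add] at this
    simp [this, hqC]
  have : Module.Free R C := Module.free_of_flat_of_isLocalRing
  let b := Module.finBasis R C
  suffices e' : Y ≃ₗ[R] X × C from
    ⟨_, ⟨e'.trans ((LinearEquiv.refl R X).prodCongr b.equivFun)⟩⟩
  refine LinearEquiv.ofLinearMap (Sc.prod q) (Φc.coprod C.subtype)
    (LinearMap.ext fun ⟨x, z⟩ => ?_) (LinearMap.ext fun y => ?_)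
  · have hz : Sc z = 0 := z.2
    have hx : q (Φc x) = 0 := by ext; rw [hq, h1, sub_self]; rfl
    simp [h1, hz, hx, hqC]
  · simp [hq]

end Localization

end PolynomialLocalization

section CharacteristicSequence

open Polynomial

variable {R A : Type*} [CommRing R] [CommRing A] [Algebra R A] [Algebra R[X] A]
  [IsScalarTower R R[X] A]
variable {Z P : Type*} [AddCommGroup Z] [Module R Z] [AddCommGroup P] [Module R P] [Module A P]
  [IsScalarTower R A P]

/-- The coefficient of `t ^ i`, as a map `Z[t] → Z`. -/
def polyCoeff (Z : Type*) [AddCommGroup Z] [Module R Z] (i : ℕ) : R[X] ⊗[R] Z →ₗ[R] Z :=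
  TensorProduct.lid R Z ∘ₗ LinearMap.rTensor Z (lcoeff R i)

@[simp]
lemma polyCoeff_tmul (i : ℕ) (p : R[X]) (z : Z) : polyCoeff Z i (p ⊗ₜ z) = p.coeff i • z := by
  simp [polyCoeff]

lemma eq_zero_of_polyCoeff_eq_zero {w : R[X] ⊗[R] Z} (h : ∀ i, polyCoeff Z i w = 0) : w = 0 := by
  have key : ∀ (w : R[X] ⊗[R] Z) (i : ℕ),
      equivFinsuppOfBasisLeft (N := Z) (basisMonomials R) w i = polyCoeff Z i w := by
    intro w i
    induction w with
    | zero => simp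
    | add x y hx hy => rw [map_add, map_add, Finsupp.add_apply, hx, hy]
    | tmul q z =>
      rw [equivFinsuppOfBasisLeft_apply_tmul, polyCoeff_tmul, Finsupp.mapRange_apply]
      rfl
  refine (equivFinsuppOfBasisLeft (N := Z) (basisMonomials R)).map_eq_zero_iff.1 ?_
  ext i
  rw [key, h, Finsupp.zero_apply]

lemma polyCoeff_X_smul_zero (w : R[X] ⊗[R] Z) : polyCoeff Z 0 ((X : R[X]) • w) = 0 := by
  induction w with
  | zero => simp
  | add x y hx hy => simp [hx, hy]
  | tmul q z => simp [smul_tmul']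

lemma polyCoeff_X_smul_succ (i : ℕ) (w : R[X] ⊗[R] Z) :
    polyCoeff Z (i + 1) ((X : R[X]) • w) = polyCoeff Z i w := by
  induction w with
  | zero => simp
  | add x y hx hy => simp [hx, hy]
  | tmul q z => simp [smul_tmul']

lemma polyCoeff_baseChange (i : ℕ) (τ : Module.End R Z) (w : R[X] ⊗[R] Z) :
    polyCoeff Z i (τ.baseChange R[X] w) = τ (polyCoeff Z i w) := by
  induction w with
  | zero => simp
  | add x y hx hy => simp [hx, hy]
  | tmul q z => simp

lemma eq_zero_of_X_smul_eq_baseChange {τ : Module.End R Z} (hτ : Function.Injective τ)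
    {w : R[X] ⊗[R] Z} (h : (X : R[X]) • w = τ.baseChange R[X] w) : w = 0 := by
  refine eq_zero_of_polyCoeff_eq_zero fun i => hτ ?_
  rw [map_zero, ← polyCoeff_baseChange, ← h]
  induction i with
  | zero => exact polyCoeff_X_smul_zero w
  | succ i ih =>
    rw [polyCoeff_X_smul_succ]
    apply hτ
    rw [map_zero, ← polyCoeff_baseChange, ← h, ih]

variable (A) in
/-- The endomorphism `t ⊗ 1 - 1 ⊗ τ` of `A ⊗ Z`. -/
def charEnd (τ : Module.End R Z) : A ⊗[R] Z →ₗ[A] A ⊗[R] Z :=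
  algebraMap R[X] A X • LinearMap.id - τ.baseChange A

omit [IsScalarTower R R[X] A] in
@[simp]
lemma charEnd_apply (τ : Module.End R Z) (z : A ⊗[R] Z) :
    charEnd A τ z = algebraMap R[X] A X • z - τ.baseChange A z := rfl

lemma polyTensor_baseChange (τ : Module.End R Z) (w : R[X] ⊗[R] Z) :
    polyTensor A Z (τ.baseChange R[X] w) = τ.baseChange A (polyTensor A Z w) := by
  induction w with
  | zero => simp
  | add x y hx hy => simp [hx, hy]
  | tmul q z => simp

lemma charEnd_injective (T : Submonoid R[X]) [IsLocalization T A]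
    (ρ : A →ₗ[R] R[X]) (hρ : ∀ p, ρ (algebraMap R[X] A p) = p)
    {τ : Module.End R Z} (hτ : Function.Injective τ) : Function.Injective (charEnd A τ) := by
  rw [injective_iff_map_eq_zero]
  intro z hz
  obtain ⟨g, hg, w, hw⟩ := exists_smul_mem_range_polyTensor T z
  have hw0 : w = 0 := by
    refine eq_zero_of_X_smul_eq_baseChange hτ (polyTensor_injective (A := A) ρ hρ ?_)
    rw [polyTensor_smul, polyTensor_baseChange, ← sub_eq_zero, ← charEnd_apply, hw, map_smul, hz,
      smul_zero]
  rw [hw0, map_zero, eq_comm] at hw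
  exact (IsLocalization.map_units A ⟨g, hg⟩).smul_eq_zero.1 hw

variable (R A P) in
/-- Multiplication by `t` as an `R`-linear endomorphism of an `A`-module. -/
def mulX : Module.End R P := Algebra.lsmul R R P (algebraMap R[X] A X)

variable (R A P) in
/-- The multiplication map `A ⊗ P → P`. -/
def mulTensor : A ⊗[R] P →ₗ[A] P := (LinearMap.id : P →ₗ[R] P).liftBaseChange A

omit [IsScalarTower R R[X] A] in
@[simp]
lemma mulX_apply (p : P) : mulX R A P p = algebraMap R[X] A X • p := rfl

omit [Algebra R[X] A] [IsScalarTower R R[X] A] in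
@[simp]
lemma mulTensor_tmul (a : A) (p : P) : mulTensor R A P (a ⊗ₜ p) = a • p := by
  simp [mulTensor]

omit [IsScalarTower R R[X] A] in
@[simp]
lemma mulTensor_charEnd (z : A ⊗[R] P) : mulTensor R A P (charEnd A (mulX R A P) z) = 0 := by
  induction z with
  | zero => simp
  | add x y hx hy => rw [map_add, map_add, hx, hy, add_zero]
  | tmul a p =>
    simp only [charEnd_apply, LinearMap.baseChange_tmul, map_sub, map_smul, mulTensor_tmul,
      mulX_apply]
    rw [smul_comm, sub_self]

/-- Every polynomial multiple of an element of `N`, for a submodule `N` stable under `t`,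
agrees with an element of `N` up to the image of `t ⊗ 1 - 1 ⊗ t`. -/
lemma exists_polyTensor_eq_add_charEnd {N : Submodule R P}
    (hN : ∀ n ∈ N, mulX R A P n ∈ N) (p : R[X]) (n : P) (hn : n ∈ N) :
    ∃ n' ∈ N, ∃ u ∈ N.baseChange A,
      algebraMap R[X] A p ⊗ₜ[R] n = 1 ⊗ₜ n' + charEnd A (mulX R A P) u := by
  induction p using Polynomial.induction_on' generalizing n with
  | add p q hp hq =>
    obtain ⟨n₁, hn₁, u₁, hu₁, h₁⟩ := hp n hn
    obtain ⟨n₂, hn₂, u₂, hu₂, h₂⟩ := hq n hn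
    refine ⟨n₁ + n₂, N.add_mem hn₁ hn₂, u₁ + u₂, Submodule.add_mem _ hu₁ hu₂, ?_⟩
    rw [map_add, add_tmul, h₁, h₂, tmul_add, map_add]
    abel
  | monomial i r =>
    induction i generalizing n with
    | zero =>
      refine ⟨r • n, N.smul_mem r hn, 0, Submodule.zero_mem _, ?_⟩
      rw [map_zero, add_zero, monomial_zero_left, ← algebraMap_eq, ← IsScalarTower.algebraMap_apply,
        Algebra.algebraMap_eq_smul_one, smul_tmul]
    | succ i ih =>
      obtain ⟨n', hn', u, hu, h⟩ := ih (mulX R A P n) (hN n hn)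
      refine ⟨n', hn', u + algebraMap R[X] A (monomial i r) ⊗ₜ n,
        Submodule.add_mem _ hu (N.tmul_mem_baseChange_of_mem _ hn), ?_⟩
      rw [map_add, ← add_assoc, ← h, charEnd_apply, LinearMap.baseChange_tmul, smul_tmul',
        smul_eq_mul, ← map_mul, X_mul_monomial]
      abel

lemma ker_mulTensor_le (T : Submonoid R[X]) [IsLocalization T A] {N : Submodule R P}
    (hN : ∀ n ∈ N, mulX R A P n ∈ N) {z : A ⊗[R] P} (hz : z ∈ N.baseChange A)
    (hz0 : mulTensor R A P z = 0) : ∃ u ∈ N.baseChange A, charEnd A (mulX R A P) u = z := by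
  obtain ⟨z', rfl⟩ := N.toBaseChange_surjective' A hz
  obtain ⟨g, hg, w, hw⟩ := exists_smul_mem_range_polyTensor T z'
  have key : ∀ w : R[X] ⊗[R] N, ∃ n' ∈ N, ∃ u ∈ N.baseChange A,
      (N.toBaseChange A (polyTensor A N w) : A ⊗[R] P) =
        1 ⊗ₜ n' + charEnd A (mulX R A P) u := by
    intro w
    induction w with
    | zero => exact ⟨0, N.zero_mem, 0, Submodule.zero_mem _, by simp⟩
    | add x y hx hy =>
      obtain ⟨n₁, hn₁, u₁, hu₁, h₁⟩ := hx
      obtain ⟨n₂, hn₂, u₂, hu₂, h₂⟩ := hy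
      refine ⟨n₁ + n₂, N.add_mem hn₁ hn₂, u₁ + u₂, Submodule.add_mem _ hu₁ hu₂, ?_⟩
      rw [map_add, map_add, Submodule.coe_add, h₁, h₂, tmul_add, map_add]
      abel
    | tmul p n => exact exists_polyTensor_eq_add_charEnd hN p n n.2
  obtain ⟨n', -, u, hu, h⟩ := key w
  rw [hw, map_smul, Submodule.coe_smul] at h
  have hn' : n' = 0 := by
    have := congrArg (mulTensor R A P) h
    rwa [map_smul, hz0, smul_zero, map_add, mulTensor_charEnd, add_zero, mulTensor_tmul, one_smul,
      eq_comm] at this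
  rw [hn', tmul_zero, zero_add] at h
  obtain ⟨v, hv⟩ := (IsLocalization.map_units A ⟨g, hg⟩).exists_left_inv
  refine ⟨v • u, Submodule.smul_mem _ _ hu, ?_⟩
  rw [map_smul, ← h, ← mul_smul, hv, one_smul]

variable (A) in
/-- The submodule `M₀ + t M₀ + ⋯ + t ^ n M₀` of an `A`-module. -/
def degreeFiltration (M₀ : Submodule R P) : ℕ → Submodule R P
  | 0 => M₀
  | n + 1 => degreeFiltration M₀ n ⊔ (degreeFiltration M₀ n).map (mulX R A P)

omit [IsScalarTower R R[X] A] in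
lemma degreeFiltration_mono (M₀ : Submodule R P) : Monotone (degreeFiltration A M₀) :=
  monotone_nat_of_le_succ fun _ => le_sup_left

omit [IsScalarTower R R[X] A] in
lemma degreeFiltration_fg {M₀ : Submodule R P} (h : M₀.FG) (n : ℕ) :
    (degreeFiltration A M₀ n).FG := by
  induction n with
  | zero => exact h
  | succ n ih => exact ih.sup (ih.map _)

omit [IsScalarTower R R[X] A] in
lemma mulX_mem_degreeFiltration {M₀ : Submodule R P} {n : ℕ} {x : P}
    (hx : x ∈ degreeFiltration A M₀ n) : mulX R A P x ∈ degreeFiltration A M₀ (n + 1) :=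
  Submodule.mem_sup_right (Submodule.mem_map_of_mem hx)

omit [IsScalarTower R R[X] A] in
lemma charEnd_mem_baseChange {N N' : Submodule R P} (h : N ≤ N')
    (hN : ∀ n ∈ N, mulX R A P n ∈ N') {z : A ⊗[R] P} (hz : z ∈ N.baseChange A) :
    charEnd A (mulX R A P) z ∈ N'.baseChange A := by
  obtain ⟨z', rfl⟩ := N.toBaseChange_surjective' A hz
  induction z' with
  | zero => simp
  | add x y hx hy =>
    rw [map_add, Submodule.coe_add, map_add]
    exact Submodule.add_mem _ (hx (Subtype.prop _)) (hy (Subtype.prop _))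
  | tmul a n =>
    rw [Submodule.coe_toBaseChange_tmul, charEnd_apply, LinearMap.baseChange_tmul]
    exact Submodule.sub_mem _ (Submodule.smul_mem _ _ (N'.tmul_mem_baseChange_of_mem _ (h n.2)))
      (N'.tmul_mem_baseChange_of_mem _ (hN n n.2))

omit [Algebra R[X] A] [IsScalarTower R R[X] A] [Module A P] [IsScalarTower R A P] in
lemma exists_mem_baseChange_of_iSup {M : ℕ → Submodule R P} (hM : Monotone M) {z : A ⊗[R] P}
    (hz : z ∈ (⨆ n, M n).baseChange A) : ∃ n, z ∈ (M n).baseChange A := by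
  obtain ⟨z', rfl⟩ := Submodule.toBaseChange_surjective' A _ hz
  clear hz
  induction z' with
  | zero => exact ⟨0, by simp⟩
  | add x y hx hy =>
    obtain ⟨i, hi⟩ := hx
    obtain ⟨j, hj⟩ := hy
    refine ⟨max i j, ?_⟩
    rw [map_add, Submodule.coe_add]
    exact Submodule.add_mem _ (Submodule.baseChange_mono _ (hM (le_max_left i j)) hi)
      (Submodule.baseChange_mono _ (hM (le_max_right i j)) hj)
  | tmul a m =>
    obtain ⟨n, hn⟩ := (Submodule.mem_iSup_of_directed _ hM.directed_le).1 m.2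
    exact ⟨n, (M n).tmul_mem_baseChange_of_mem _ hn⟩

omit [IsScalarTower R R[X] A] in
/-- Modulo the image of `t ⊗ 1 - 1 ⊗ t`, the base change of a filtration step is generated by
degree zero. -/
lemma baseChange_degreeFiltration_le (M₀ : Submodule R P) (n : ℕ) :
    (degreeFiltration A M₀ (n + 1)).baseChange A ≤ M₀.baseChange A ⊔
      ((degreeFiltration A M₀ n).baseChange A).map (charEnd A (mulX R A P)) := by
  have step : ∀ n, (degreeFiltration A M₀ (n + 1)).baseChange A ≤
      (degreeFiltration A M₀ n).baseChange A ⊔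
        ((degreeFiltration A M₀ n).baseChange A).map (charEnd A (mulX R A P)) := by
    intro n
    rw [Submodule.baseChange_eq_span, Submodule.span_le]
    rintro _ ⟨x, hx, rfl⟩
    obtain ⟨y, hy, _, ⟨m, hm, rfl⟩, rfl⟩ := Submodule.mem_sup.1 hx
    have hm' := (degreeFiltration A M₀ n).tmul_mem_baseChange_of_mem (1 : A) hm
    have : (1 : A) ⊗ₜ[R] (y + mulX R A P m) =
        (1 ⊗ₜ y + algebraMap R[X] A X • 1 ⊗ₜ m) + charEnd A (mulX R A P) (-(1 ⊗ₜ m)) := by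
      rw [map_neg, charEnd_apply, LinearMap.baseChange_tmul, tmul_add]
      abel
    simp only [TensorProduct.mk_apply, SetLike.mem_coe]
    rw [this]
    exact Submodule.add_mem_sup
      (Submodule.add_mem _ (Submodule.tmul_mem_baseChange_of_mem _ hy) (Submodule.smul_mem _ _ hm'))
      (Submodule.mem_map_of_mem (Submodule.neg_mem _ hm'))
  induction n with
  | zero => exact step 0
  | succ n ih =>
    refine (step (n + 1)).trans (sup_le (ih.trans (sup_le_sup_left ?_ _)) le_sup_right)
    exact Submodule.map_mono (Submodule.baseChange_mono _ (degreeFiltration_mono M₀ n.le_succ))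

/-- A finitely generated projective `A`-module is, up to adding an extended module, itself
extended from `R`. -/
lemma exists_baseChange_equiv_prod (T : Submonoid R[X]) [IsLocalization T A] [Module.Flat R A]
    (hX : (X : R[X]) ∈ T)
    (ρ : A →ₗ[R] R[X]) (hρ : ∀ p, ρ (algebraMap R[X] A p) = p)
    [Module.Finite A P] [Module.Projective A P] :
    ∃ N N' : Submodule R P, N.FG ∧ N'.FG ∧
      Nonempty ((A ⊗[R] N') ≃ₗ[A] ((A ⊗[R] N) × P)) := by
  obtain ⟨s, hs⟩ := Module.Finite.fg_top (R := A) (M := P)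
  let M₀ : Submodule R P := Submodule.span R s
  let M := degreeFiltration A M₀
  have hM : Monotone M := degreeFiltration_mono M₀
  have hM₀fg : M₀.FG := ⟨s, rfl⟩
  let φ := charEnd A (mulX R A P)
  have hφ : Function.Injective φ := charEnd_injective T ρ hρ
    fun _ _ h => (IsLocalization.map_units A (⟨X, hX⟩ : T)).smul_left_cancel.1 h
  have hsurj : ∀ p, ∃ z ∈ M₀.baseChange A, mulTensor R A P z = p := by
    intro p
    have : ⊤ ≤ (M₀.baseChange A).map (mulTensor R A P) := by
      rw [← hs, Submodule.span_le]
      intro x hx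
      exact ⟨1 ⊗ₜ x, M₀.tmul_mem_baseChange_of_mem _ (Submodule.subset_span hx), by simp⟩
    exact this (Submodule.mem_top (x := p))
  have := Module.finitePresentation_of_projective A P
  have : Module.Finite R M₀ := Module.Finite.iff_fg.2 hM₀fg
  have : Module.Finite A (M₀.baseChange A) :=
    Module.Finite.of_surjective _ (M₀.toBaseChange_surjective A)
  let ψ₀ : M₀.baseChange A →ₗ[A] P := mulTensor R A P ∘ₗ (M₀.baseChange A).subtype
  have hψ₀ : Function.Surjective ψ₀ := fun p => by
    obtain ⟨z, hz, h⟩ := hsurj p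
    exact ⟨⟨z, hz⟩, h⟩
  have hstable : ∀ x ∈ ⨆ n, M n, mulX R A P x ∈ ⨆ n, M n := by
    intro x hx
    obtain ⟨n, hn⟩ := (Submodule.mem_iSup_of_directed _ hM.directed_le).1 hx
    exact Submodule.mem_iSup_of_mem (n + 1) (mulX_mem_degreeFiltration hn)
  have hker : ∀ z ∈ M₀.baseChange A, mulTensor R A P z = 0 →
      ∃ n, z ∈ ((M n).baseChange A).map φ := by
    intro z hz hz0
    obtain ⟨u, hu, rfl⟩ := ker_mulTensor_le T hstable
      (Submodule.baseChange_mono _ (le_iSup M 0) hz) hz0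
    obtain ⟨n, hn⟩ := exists_mem_baseChange_of_iSup hM hu
    exact ⟨n, Submodule.mem_map_of_mem hn⟩
  have hmono : Monotone fun n => ((M n).baseChange A).map φ := fun i j hij =>
    Submodule.map_mono (Submodule.baseChange_mono _ (hM hij))
  obtain ⟨n, hn⟩ : ∃ n, ∀ z ∈ M₀.baseChange A, mulTensor R A P z = 0 →
      z ∈ ((M n).baseChange A).map φ := by
    obtain ⟨S, hS⟩ := Module.FinitePresentation.fg_ker (R := A) (M := M₀.baseChange A)
      (N := P) ψ₀ hψ₀
    choose! ν hν using hker
    refine ⟨S.sup fun z => ν z, fun z hz hz0 => ?_⟩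
    have hle : LinearMap.ker ψ₀ ≤
        (((M (S.sup fun z => ν z)).baseChange A).map φ).comap (M₀.baseChange A).subtype := by
      rw [← hS, Submodule.span_le]
      intro y hy
      have hy0 : ψ₀ y = 0 := by
        rw [← LinearMap.mem_ker, ← hS]
        exact Submodule.subset_span hy
      exact hmono (Finset.le_sup (f := fun z : M₀.baseChange A => ν z) hy) (hν y y.2 hy0)
    exact hle (x := ⟨z, hz⟩) hz0
  refine ⟨M n, M (n + 1), degreeFiltration_fg hM₀fg n, degreeFiltration_fg hM₀fg (n + 1), ?_⟩
  let L := (M n).baseChange A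
  let L' := (M (n + 1)).baseChange A
  have hLL' : ∀ z ∈ L, φ z ∈ L' := fun z hz =>
    charEnd_mem_baseChange (hM n.le_succ) (fun _ => mulX_mem_degreeFiltration) hz
  let f : L →ₗ[A] L' := φ.restrict hLL'
  let ψ : L' →ₗ[A] P := mulTensor R A P ∘ₗ L'.subtype
  have hf : Function.Injective f := fun a b hab =>
    Subtype.ext (hφ (congrArg Subtype.val hab))
  have hψ : Function.Surjective ψ := fun p => by
    obtain ⟨z, hz, h⟩ := hsurj p
    exact ⟨⟨z, Submodule.baseChange_mono _ (hM (Nat.zero_le _)) hz⟩, h⟩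
  have hexact : Function.Exact f ψ := by
    intro y
    constructor
    · intro hy
      obtain ⟨y₀, hy₀, _, ⟨x, hx, rfl⟩, h⟩ :=
        Submodule.mem_sup.1 (baseChange_degreeFiltration_le M₀ n y.2)
      have hy₀0 : mulTensor R A P y₀ = 0 := by
        have : mulTensor R A P (y : A ⊗[R] P) = 0 := hy
        rwa [← h, map_add, mulTensor_charEnd, add_zero] at this
      obtain ⟨x', hx', rfl⟩ := hn y₀ hy₀ hy₀0
      refine ⟨⟨x' + x, L.add_mem hx' hx⟩, Subtype.ext ?_⟩
      rw [← h, ← map_add]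
      rfl
    · rintro ⟨x, rfl⟩
      exact mulTensor_charEnd _
  obtain ⟨σ, hσ⟩ := Module.projective_lifting_property ψ LinearMap.id hψ
  have e : L' ≃ₗ[A] L × P := (Function.Exact.splitSurjectiveEquiv (R := A) (M := L) (N := L')
    (P := P) hexact hf ⟨σ, hσ⟩).1
  exact ⟨(Submodule.toBaseChange.toLinearEquiv A _).trans (e.trans
    ((Submodule.toBaseChange.toLinearEquiv A _).symm.prodCongr (LinearEquiv.refl A P)))⟩

end CharacteristicSequence

section StablyExtended

open Polynomial

variable {R A : Type*} [CommRing R] [CommRing A] [Algebra R A] [Algebra R[X] A]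
  [IsScalarTower R R[X] A]
variable {P : Type*} [AddCommGroup P] [Module R P] [Module A P] [IsScalarTower R A P]

/-- Let `R` be local and let `A` be a localization of `R[t]` at polynomials having unit values.
A finitely generated projective `A`-module becomes free after adding an extended module,
up to the same extended module. -/
lemma exists_prod_baseChange_equiv [IsLocalRing R] (T : Submonoid R[X]) [IsLocalization T A]
    [Module.Flat R A] (hX : (X : R[X]) ∈ T) (hT : ∀ g ∈ T, ∃ c, IsUnit (g.eval c))
    (ρ : A →ₗ[R] R[X]) (hρ : ∀ p, ρ (algebraMap R[X] A p) = p)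
    [Module.Finite A P] [Module.Projective A P] :
    ∃ N : Submodule R P, N.FG ∧ ∃ n : ℕ,
      Nonempty ((P × (A ⊗[R] N)) ≃ₗ[A] ((Fin n → A) × (A ⊗[R] N))) := by
  obtain ⟨N, N', hN, hN', ⟨e⟩⟩ := exists_baseChange_equiv_prod (P := P) T hX ρ hρ
  have : Module.Finite R N := Module.Finite.iff_fg.2 hN
  have : Module.Finite R N' := Module.Finite.iff_fg.2 hN'
  obtain ⟨n, ⟨e'⟩⟩ := exists_equiv_prod_of_baseChange T ρ hρ hT e
  have e'' : (A ⊗[R] N') ≃ₗ[A] ((Fin n → A) × (A ⊗[R] N)) :=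
    (e'.baseChange R A _ _).trans ((TensorProduct.prodRight R A A N (Fin n → R)).trans
      (((LinearEquiv.refl A _).prodCongr (piScalarRight R A A (Fin n))).trans
        (LinearEquiv.prodComm A _ _)))
  exact ⟨N, hN, n, ⟨(LinearEquiv.prodComm A _ _).trans (e.symm.trans e'')⟩⟩

end StablyExtended

section RationalFunctions

open Polynomial

variable (k R : Type*) [Field k] [CommRing R] [Algebra k R]

/-- `R ⊗ k(t)` as an algebra over `R[t]`. -/
@[reducible]
def polynomialAlgebraTensorRatFunc : Algebra R[X] (R ⊗[k] RatFunc k) :=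
  (aeval (R := R) ((1 : R) ⊗ₜ[k] (RatFunc.X : RatFunc k))).toAlgebra

attribute [local instance] polynomialAlgebraTensorRatFunc

lemma algebraMap_tensorRatFunc_eq_aeval (p : R[X]) :
    algebraMap R[X] (R ⊗[k] RatFunc k) p = aeval ((1 : R) ⊗ₜ[k] (RatFunc.X : RatFunc k)) p :=
  rfl

lemma isScalarTower_tensorRatFunc : IsScalarTower R R[X] (R ⊗[k] RatFunc k) :=
  IsScalarTower.of_algebraMap_eq fun r => by
    rw [algebraMap_tensorRatFunc_eq_aeval, algebraMap_eq, aeval_C]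

lemma algebraMap_tensorRatFunc_monomial (i : ℕ) (r : R) :
    algebraMap R[X] (R ⊗[k] RatFunc k) (monomial i r) =
      r ⊗ₜ algebraMap k[X] (RatFunc k) (X ^ i) := by
  rw [algebraMap_tensorRatFunc_eq_aeval, aeval_monomial, Algebra.TensorProduct.tmul_pow,
    Algebra.TensorProduct.algebraMap_apply, Algebra.TensorProduct.tmul_mul_tmul]
  simp

lemma algebraMap_tensorRatFunc_map (q : k[X]) :
    algebraMap R[X] (R ⊗[k] RatFunc k) (q.map (algebraMap k R)) =
      1 ⊗ₜ algebraMap k[X] (RatFunc k) q := by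
  induction q using Polynomial.induction_on' with
  | add p q hp hq => rw [Polynomial.map_add, map_add, hp, hq, map_add, tmul_add]
  | monomial i c =>
    rw [map_monomial, algebraMap_tensorRatFunc_monomial, Algebra.algebraMap_eq_smul_one, smul_tmul,
      ← smul_X_eq_monomial, Algebra.smul_def, Algebra.smul_def, map_mul]
    rfl

/-- The `R`-module `R[t]` is a retract of `R ⊗ k(t)`. -/
lemma exists_retraction_tensorRatFunc :
    ∃ ρ : R ⊗[k] RatFunc k →ₗ[R] R[X],
      ∀ p, ρ (algebraMap R[X] (R ⊗[k] RatFunc k) p) = p := by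
  obtain ⟨ρ₀, h⟩ := LinearMap.exists_leftInverse_of_injective
    ((Algebra.linearMap k[X] (RatFunc k)).restrictScalars k)
    (LinearMap.ker_eq_bot.2 (RatFunc.algebraMap_injective k))
  have hρ₀ : ∀ q, ρ₀ (algebraMap k[X] (RatFunc k) q) = q := LinearMap.congr_fun h
  refine ⟨((mapAlgHom (Algebra.ofId k R)).toLinearMap ∘ₗ ρ₀).liftBaseChange R, fun p => ?_⟩
  induction p using Polynomial.induction_on' with
  | add p q hp hq => rw [map_add, map_add, hp, hq]
  | monomial i r =>
    rw [algebraMap_tensorRatFunc_monomial, LinearMap.liftBaseChange_tmul, LinearMap.comp_apply, hρ₀]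
    simp [smul_X_eq_monomial]

/-- The nonzero polynomials over `k`, as a multiplicative subset of `R[t]`. -/
def nonzeroConstantPolynomials : Submonoid R[X] :=
  (nonZeroDivisors k[X]).map (mapRingHom (algebraMap k R))

lemma isLocalization_tensorRatFunc :
    IsLocalization (nonzeroConstantPolynomials k R) (R ⊗[k] RatFunc k) := by
  obtain ⟨ρ, hρ⟩ := exists_retraction_tensorRatFunc k R
  rw [isLocalization_iff]
  refine ⟨?_, fun z => ?_, fun {x y} h => ⟨1, ?_⟩⟩
  · rintro ⟨_, q, hq, rfl⟩
    have hu : IsUnit (algebraMap k[X] (RatFunc k) q) := IsLocalization.map_units _ ⟨q, hq⟩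
    change IsUnit (algebraMap R[X] (R ⊗[k] RatFunc k) (q.map (algebraMap k R)))
    rw [algebraMap_tensorRatFunc_map]
    exact hu.map (Algebra.TensorProduct.includeRight : RatFunc k →ₐ[k] R ⊗[k] RatFunc k)
  · induction z with
    | zero => exact ⟨(0, 1), by simp⟩
    | add x y hx hy =>
      obtain ⟨⟨p, g⟩, h⟩ := hx
      obtain ⟨⟨p', g'⟩, h'⟩ := hy
      refine ⟨(p * g' + p' * g, g * g'), ?_⟩
      simp only [Submonoid.coe_mul, map_mul, map_add] at h h' ⊢
      rw [← h, ← h']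
      ring
    | tmul r f =>
      refine ⟨(C r * f.num.map (algebraMap k R), ⟨f.denom.map (algebraMap k R), f.denom,
        mem_nonZeroDivisors_of_ne_zero f.denom_ne_zero, rfl⟩), ?_⟩
      have hf : f * algebraMap k[X] (RatFunc k) f.denom = algebraMap k[X] (RatFunc k) f.num :=
        (eq_div_iff (RatFunc.algebraMap_ne_zero f.denom_ne_zero)).1 (RatFunc.num_div_denom f).symm
      have hC : algebraMap R[X] (R ⊗[k] RatFunc k) (C r) = r ⊗ₜ 1 := by
        rw [algebraMap_tensorRatFunc_eq_aeval, aeval_C, Algebra.TensorProduct.algebraMap_apply]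
        rfl
      rw [map_mul, algebraMap_tensorRatFunc_map, algebraMap_tensorRatFunc_map, hC,
        Algebra.TensorProduct.tmul_mul_tmul, Algebra.TensorProduct.tmul_mul_tmul, hf, mul_one,
        one_mul]
  · rw [← hρ x, ← hρ y, h]

lemma exists_prod_tensorRatFunc_equiv [Infinite k] [IsLocalRing R]
    (P : Type*) [AddCommGroup P] [Module R P] [Module (R ⊗[k] RatFunc k) P]
    [IsScalarTower R (R ⊗[k] RatFunc k) P]
    [Module.Finite (R ⊗[k] RatFunc k) P] [Module.Projective (R ⊗[k] RatFunc k) P] :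
    ∃ N : Submodule R P, N.FG ∧ ∃ n : ℕ,
      Nonempty ((P × ((R ⊗[k] RatFunc k) ⊗[R] N)) ≃ₗ[R ⊗[k] RatFunc k]
        ((Fin n → R ⊗[k] RatFunc k) × ((R ⊗[k] RatFunc k) ⊗[R] N))) := by
  have := isScalarTower_tensorRatFunc k R
  have := isLocalization_tensorRatFunc k R
  obtain ⟨ρ, hρ⟩ := exists_retraction_tensorRatFunc k R
  refine exists_prod_baseChange_equiv (nonzeroConstantPolynomials k R) ?_ ?_ ρ hρ
  · exact ⟨X, mem_nonZeroDivisors_of_ne_zero X_ne_zero, by simp⟩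
  · rintro _ ⟨q, hq, rfl⟩
    obtain ⟨c, hc⟩ : ∃ c, q.eval c ≠ 0 := by
      by_contra! h
      exact nonZeroDivisors.ne_zero hq (zero_of_eval_zero q h)
    refine ⟨algebraMap k R c, ?_⟩
    rw [coe_mapRingHom, eval_map_algebraMap, aeval_algebraMap_apply]
    exact (IsUnit.mk0 _ hc).map (algebraMap k R)

end RationalFunctions

/-- **Yoshino, Lemma 7.2.**  Let `k` be an infinite field, `(R, 𝔪, k)` a commutative
noetherian local `k`-algebra and `K = k(t)`.  Given a finitely generated projective
`R ⊗_k K`-module `P`, there are a finitely generated `R`-module `X` and `n ∈ ℕ` with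
`P ⊕ (X ⊗_k K) ≅ (R^n ⊗_k K) ⊕ (X ⊗_k K)` as `R ⊗_k K`-modules; here `X ⊗_k K` is the
base change `(R ⊗_k K) ⊗_R X` and `R^n ⊗_k K` is the free module `(R ⊗_k K)^n`. -/
theorem projective_stably_extended_from_R
    (k : Type) [Field k] [Infinite k]
    (R : Type) [CommRing R] [Algebra k R] [IsNoetherianRing R] [IsLocalRing R]
    (hres : Function.Bijective (algebraMap k (R ⧸ IsLocalRing.maximalIdeal R)))
    (P : Type) [AddCommGroup P] [Module (AK k R) P]
    (hfg : Module.Finite (AK k R) P) (hproj : Module.Projective (AK k R) P) :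
    ∃ (X : Type) (_ : AddCommGroup X) (_ : Module R X), Module.Finite R X ∧
      ∃ n : ℕ,
        Nonempty ((P × (AK k R ⊗[R] X)) ≃ₗ[AK k R]
          ((Fin n → AK k R) × (AK k R ⊗[R] X))) := by
  let : Module R P := Module.compHom P (algebraMap R (AK k R))
  have : IsScalarTower R (AK k R) P := IsScalarTower.of_algebraMap_smul fun _ _ => rfl
  let i : Module (R ⊗[k] RatFunc k) P := ‹Module (AK k R) P›
  obtain ⟨N, hN, n, ⟨e⟩⟩ : ∃ N : Submodule R P, N.FG ∧ ∃ n : ℕ,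
      Nonempty ((P × (AK k R ⊗[R] N)) ≃ₗ[AK k R] ((Fin n → AK k R) × (AK k R ⊗[R] N))) :=
    @exists_prod_tensorRatFunc_equiv k R _ _ _ _ _ P _ _ i this hfg hproj
  exact ⟨N, inferInstance, inferInstance, Module.Finite.iff_fg.2 hN, n, ⟨e⟩⟩

end
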